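/- arXiv:math/0110040 — 2 statements merged into one kernel-verified Lean document; each statement's English description precedes it below -/
import Mathlib

section
/- For all n ≥ 1 and 0 ≤ k ≤ n−1, the number of permutations of length n that avoid the pattern 1-3-2 and have exactly k descents equals the Narayana number N(n,k) = (1/n)·binomial(n,k)·binomial(n,k+1). -/
/-- An occurrence of the classical pattern 1-3-2 in a sequence `w` of distinct
integers is a triple of indices `i < j < k` with `w i < w k < w j`;
`w` avoids 1-3-2 if it has no such occurrence. -/
def Avoids132 {m : ℕ} (w : Fin m → ℤ) : Prop :=
  ∀ i j k : Fin m, i < j → j < k → ¬(w i < w k ∧ w k < w j)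

/-- `π : Fin n → ℤ` is a permutation of length `n`, i.e. a sequence containing
each of the integers `1,…,n` exactly once. -/
def IsPermSeq (n : ℕ) (π : Fin n → ℤ) : Prop :=
  Function.Injective π ∧ ∀ i, 1 ≤ π i ∧ π i ≤ (n : ℤ)

/-- The prefix `π' = (π_1, …, π_{j-1})` of `π` strictly before position `j`. -/
def leftPart {n : ℕ} (π : Fin n → ℤ) (j : Fin n) : Fin (j : ℕ) → ℤ :=
  fun a => π ⟨(a : ℕ), lt_trans a.isLt j.isLt⟩

/-- The suffix `π'' = (π_{j+1}, …, π_n)` of `π` strictly after position `j`. -/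
def rightPart {n : ℕ} (π : Fin n → ℤ) (j : Fin n) : Fin (n - (j : ℕ) - 1) → ℤ :=
  fun a => π ⟨(j : ℕ) + 1 + (a : ℕ), by have h1 := a.isLt; have h2 := j.isLt; omega⟩

/-- An occurrence of the generalized pattern `12-3-…-k` in `w`:
indices `i 0 < i 1 < ⋯ < i (k-1)` with `i 1 = i 0 + 1` and
`w (i 0) < w (i 1) < ⋯ < w (i (k-1))`. -/
def Occ12 {m : ℕ} (k : ℕ) (w : Fin m → ℤ) (i : Fin k → Fin m) : Prop :=
  StrictMono i ∧ StrictMono (w ∘ i) ∧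
    ∀ a b : Fin k, (a : ℕ) = 0 → (b : ℕ) = 1 → (i b : ℕ) = (i a : ℕ) + 1

/-- The relative order of the letters of the pattern `21-3-…-k`. -/
def fPat (j : ℕ) : ℕ := if j = 0 then 1 else if j = 1 then 0 else j

/-- An occurrence of the generalized pattern `21-3-…-k` in `w`:
indices `i 0 < i 1 < ⋯ < i (k-1)` with `i 1 = i 0 + 1` and
`w (i 1) < w (i 0) < w (i 2) < ⋯ < w (i (k-1))`. -/
def Occ21 {m : ℕ} (k : ℕ) (w : Fin m → ℤ) (i : Fin k → Fin m) : Prop :=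
  StrictMono i ∧ (∀ a b : Fin k, fPat (a : ℕ) < fPat (b : ℕ) ↔ w (i a) < w (i b)) ∧
    ∀ a b : Fin k, (a : ℕ) = 0 → (b : ℕ) = 1 → (i b : ℕ) = (i a : ℕ) + 1

/-- `eStat k w` is the number of occurrences of the generalized pattern
`12-3-…-k` in `w` (for `k = 2` this is the number of ascents). -/
noncomputable def eStat (k : ℕ) {m : ℕ} (w : Fin m → ℤ) : ℕ :=
  Nat.card {i : Fin k → Fin m // Occ12 k w i}

/-- `fStat k w` is the number of occurrences of the generalized pattern
`21-3-…-k` in `w` (for `k = 2` this is the number of descents). -/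
noncomputable def fStat (k : ℕ) {m : ℕ} (w : Fin m → ℤ) : ℕ :=
  Nat.card {i : Fin k → Fin m // Occ21 k w i}

/-- The number of ascents of `w`: indices `i` with `w i < w (i+1)`. -/
noncomputable def asc {m : ℕ} (w : Fin m → ℤ) : ℕ :=
  Nat.card {p : Fin m × Fin m // (p.2 : ℕ) = (p.1 : ℕ) + 1 ∧ w p.1 < w p.2}

/-- The number of descents of `w`: indices `i` with `w i > w (i+1)`. -/
noncomputable def des {m : ℕ} (w : Fin m → ℤ) : ℕ :=
  Nat.card {p : Fin m × Fin m // (p.2 : ℕ) = (p.1 : ℕ) + 1 ∧ w p.2 < w p.1}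

/-- `totE w = Σ_{k ≥ 2} e_k(w)`: the total number of 2-increasing
subsequences of `w`. -/
noncomputable def totE {m : ℕ} (w : Fin m → ℤ) : ℕ :=
  Nat.card ((k : ℕ) × {i : Fin k → Fin m // 2 ≤ k ∧ Occ12 k w i})

/-- `totF w = Σ_{k ≥ 2} f_k(w)`: the total number of almost 2-increasing
subsequences of `w`. -/
noncomputable def totF {m : ℕ} (w : Fin m → ℤ) : ℕ :=
  Nat.card ((k : ℕ) × {i : Fin k → Fin m // 2 ≤ k ∧ Occ21 k w i})

section

open Finset

/-- `w : ℕ → ℤ` restricts on `{0, …, n-1}` to a 1-3-2-avoiding permutation of length `n`,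
and vanishes elsewhere. -/
def IsAvoider (n : ℕ) (w : ℕ → ℤ) : Prop :=
  (∀ i < n, 1 ≤ w i ∧ w i ≤ (n : ℤ)) ∧ (∀ i < n, ∀ j < n, w i = w j → i = j) ∧
    (∀ i, n ≤ i → w i = 0) ∧
    ∀ i j k, i < j → j < k → k < n → ¬(w i < w k ∧ w k < w j)

/-- The number of descents of the word `w 0, …, w (n-1)`. -/
def desNat (n : ℕ) (w : ℕ → ℤ) : ℕ := #{i ∈ range n | i + 1 < n ∧ w (i + 1) < w i}

/-- Extension of a finite word by zero. -/
def extendZero {n : ℕ} (π : Fin n → ℤ) (i : ℕ) : ℤ := if h : i < n then π ⟨i, h⟩ else 0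

lemma extendZero_restrict {n : ℕ} {w : ℕ → ℤ} (hw : ∀ i, n ≤ i → w i = 0) :
    extendZero (fun i : Fin n => w i) = w := by
  funext i
  unfold extendZero
  split_ifs with h
  · rfl
  · exact (hw i (by omega)).symm

lemma restrict_extendZero {n : ℕ} (π : Fin n → ℤ) :
    (fun i : Fin n => extendZero π i) = π := by
  funext i
  simp [extendZero]

lemma isAvoider_iff {n : ℕ} {w : ℕ → ℤ} (hw : ∀ i, n ≤ i → w i = 0) :
    IsAvoider n w ↔
      IsPermSeq n (fun i : Fin n => w i) ∧ Avoids132 (fun i : Fin n => w i) := by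
  constructor
  · rintro ⟨h1, h2, -, h4⟩
    exact ⟨⟨fun i j h => Fin.ext (h2 i i.2 j j.2 h), fun i => h1 i i.2⟩,
      fun i j k hij hjk => h4 i j k hij hjk k.2⟩
  · rintro ⟨⟨h1, h2⟩, h3⟩
    refine ⟨fun i hi => h2 ⟨i, hi⟩, fun i hi j hj h => ?_, hw, fun i j k hij hjk hk => ?_⟩
    · exact congrArg Fin.val (@h1 ⟨i, hi⟩ ⟨j, hj⟩ h)
    · exact h3 ⟨i, by omega⟩ ⟨j, by omega⟩ ⟨k, hk⟩ hij hjk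

lemma des_restrict (n : ℕ) (w : ℕ → ℤ) : des (fun i : Fin n => w i) = desNat n w := by
  unfold des desNat
  rw [← Nat.card_eq_finsetCard]
  refine Nat.card_congr ⟨fun p => ⟨p.1.1, ?_⟩, fun i => ⟨(⟨i.1, ?_⟩, ⟨i.1 + 1, ?_⟩), ?_⟩, ?_, ?_⟩
  · obtain ⟨⟨a, b⟩, h1, h2⟩ := p
    dsimp only at h1 h2
    rw [h1] at h2
    exact mem_filter.2 ⟨mem_range.2 a.2, h1 ▸ b.2, h2⟩
  · exact mem_range.1 (mem_filter.1 i.2).1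
  · exact (mem_filter.1 i.2).2.1
  · exact ⟨rfl, (mem_filter.1 i.2).2.2⟩
  · rintro ⟨⟨a, b⟩, h1, h2⟩
    exact Subtype.ext (Prod.ext rfl (Fin.ext h1.symm))
  · exact fun i => rfl

lemma finite_isAvoider (n : ℕ) : {w | IsAvoider n w}.Finite := by
  refine ((Fintype.piFinset fun _ : Fin n => Icc (1 : ℤ) n).finite_toSet.image extendZero).subset
    fun w hw => ⟨fun i => w i, ?_, extendZero_restrict hw.2.2.1⟩
  exact mem_coe.2 (Fintype.mem_piFinset.2 fun i => mem_Icc.2 (hw.1 i i.2))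

/-- The finite set of 1-3-2-avoiding permutations of length `n`. -/
noncomputable def avoiders (n : ℕ) : Finset (ℕ → ℤ) := (finite_isAvoider n).toFinset

@[simp] lemma mem_avoiders {n : ℕ} {w : ℕ → ℤ} : w ∈ avoiders n ↔ IsAvoider n w := by
  simp [avoiders]

lemma natCard_eq_card_avoiders (n k : ℕ) :
    Nat.card {π : Fin n → ℤ // IsPermSeq n π ∧ Avoids132 π ∧ des π = k} =
      #{w ∈ avoiders n | desNat n w = k} := by
  rw [← Nat.card_eq_finsetCard]
  refine Nat.card_congr ⟨fun π => ⟨extendZero π.1, ?_⟩, fun w => ⟨fun i => w.1 i, ?_⟩, ?_, ?_⟩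
  · obtain ⟨π, h1, h2, h3⟩ := π
    have h0 : ∀ i, n ≤ i → extendZero π i = 0 := fun i hi => dif_neg (by omega)
    rw [mem_filter, mem_avoiders, isAvoider_iff h0, ← des_restrict, restrict_extendZero]
    exact ⟨⟨h1, h2⟩, h3⟩
  · obtain ⟨w, hw⟩ := w
    rw [mem_filter, mem_avoiders] at hw
    rw [des_restrict, ← and_assoc, ← isAvoider_iff hw.1.2.2.1]
    exact hw
  · exact fun π => Subtype.ext (restrict_extendZero π.1)
  · exact fun w => Subtype.ext
      (extendZero_restrict (mem_avoiders.1 (mem_filter.1 w.2).1).2.2.1)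

/-- The word `L' (p+q+1) R`, where `L'` is the length `p` word `L` with `q` added to its letters. -/
def joinMax (p q : ℕ) (L R : ℕ → ℤ) (i : ℕ) : ℤ :=
  if i < p then L i + q else if i = p then p + q + 1 else R (i - p - 1)

lemma isAvoider_joinMax {p q : ℕ} {L R : ℕ → ℤ} (hL : IsAvoider p L) (hR : IsAvoider q R) :
    IsAvoider (p + q + 1) (joinMax p q L R) := by
  obtain ⟨l1, l2, l3, l4⟩ := hL
  obtain ⟨r1, r2, r3, r4⟩ := hR
  have lo : ∀ i < p, joinMax p q L R i = L i + q := fun i hi => by simp [joinMax, hi]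
  have mid : joinMax p q L R p = p + q + 1 := by simp [joinMax]
  have hi : ∀ i, p < i → joinMax p q L R i = R (i - p - 1) := fun i hi => by
    simp [joinMax, hi.not_gt, hi.ne']
  refine ⟨fun i hin => ?_, fun i hin j hjn => ?_, fun i hin => ?_, fun i j k hij hjk hk => ?_⟩
  · rcases lt_trichotomy i p with h | rfl | h
    · rw [lo i h]; have := l1 i h; push_cast; omega
    · rw [mid]; push_cast; omega
    · rw [hi i h]; have := r1 (i - p - 1) (by omega); push_cast; omega
  · rcases lt_trichotomy i p with h | h | h <;> rcases lt_trichotomy j p with h' | h' | h'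
    · rw [lo i h, lo j h']; exact fun e => l2 i h j h' (by omega)
    · rw [lo i h, h', mid]; have := l1 i h; omega
    · rw [lo i h, hi j h']; have := l1 i h; have := r1 (j - p - 1) (by omega); omega
    · rw [h, mid, lo j h']; have := l1 j h'; omega
    · omega
    · rw [h, mid, hi j h']; have := r1 (j - p - 1) (by omega); omega
    · rw [hi i h, lo j h']; have := l1 j h'; have := r1 (i - p - 1) (by omega); omega
    · rw [hi i h, h', mid]; have := r1 (i - p - 1) (by omega); omega
    · rw [hi i h, hi j h']
      intro e
      have := r2 (i - p - 1) (by omega) (j - p - 1) (by omega) e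
      omega
  · rw [hi i (by omega)]; exact r3 _ (by omega)
  · rintro ⟨h1, h2⟩
    rcases lt_trichotomy k p with h | h | h
    · rw [lo i (by omega), lo k h] at h1
      rw [lo k h, lo j (by omega)] at h2
      exact l4 i j k hij hjk h ⟨by omega, by omega⟩
    · rw [h, mid, lo j (by omega)] at h2
      have := l1 j (by omega)
      omega
    · rw [hi k h] at h1 h2
      have := r1 (k - p - 1) (by omega)
      rcases lt_trichotomy i p with h' | h' | h'
      · rw [lo i h'] at h1; have := l1 i h'; omega
      · rw [h', mid] at h1; omega
      · rw [hi i h'] at h1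
        rw [hi j (by omega)] at h2
        exact r4 (i - p - 1) (j - p - 1) (k - p - 1) (by omega) (by omega) (by omega) ⟨h1, h2⟩

lemma desNat_joinMax {p q : ℕ} {L R : ℕ → ℤ} (hL : IsAvoider p L) (hR : IsAvoider q R) :
    desNat (p + q + 1) (joinMax p q L R) =
      desNat p L + (if q = 0 then 0 else 1) + desNat q R := by
  unfold desNat
  simp only [card_filter]
  rw [show p + q + 1 = p + 1 + q by ring, sum_range_add _ (p + 1) q, sum_range_succ]
  congr 1
  · congr 1
    · refine sum_congr rfl fun i hi => if_congr ?_ rfl rfl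
      rw [mem_range] at hi
      rcases (show i + 1 < p ∨ i + 1 = p by omega) with h | h
      · simp [joinMax, hi, h]; omega
      · have := hL.1 i hi
        simp only [joinMax, h, hi, lt_irrefl, if_true, if_false, false_and, iff_false]
        omega
    · rcases Nat.eq_zero_or_pos q with rfl | h
      · simp
      · have := hR.1 0 h
        rw [if_pos, if_neg h.ne']
        simp [joinMax]
        omega
  · refine sum_congr rfl fun i hi => if_congr ?_ rfl rfl
    have e1 : joinMax p q L R (p + 1 + i) = R i := by
      rw [joinMax, if_neg (by omega), if_neg (by omega)]; congr 1; omega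
    have e2 : joinMax p q L R (p + 1 + i + 1) = R (i + 1) := by
      rw [joinMax, if_neg (by omega), if_neg (by omega)]; congr 1; omega
    rw [e1, e2]
    exact and_congr_left' (by omega)

lemma joinMax_injective {p q p' q' : ℕ} {L R L' R' : ℕ → ℤ} (hL : IsAvoider p L)
    (hR : IsAvoider q R) (hL' : IsAvoider p' L') (hR' : IsAvoider q' R')
    (hpq : p + q = p' + q') (h : joinMax p q L R = joinMax p' q' L' R') :
    p = p' ∧ q = q' ∧ L = L' ∧ R = R' := by
  have key := isAvoider_joinMax hL hR
  have hp : p = p' := by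
    refine key.2.1 p (by omega) p' (by omega) ?_
    rw [congrFun h p']
    simp only [joinMax, lt_irrefl, if_true, if_false]
    exact_mod_cast congrArg (· + 1) hpq
  subst hp
  obtain rfl : q = q' := by omega
  refine ⟨rfl, rfl, funext fun i => ?_, funext fun i => ?_⟩
  · rcases lt_or_ge i p with hi | hi
    · have := congrFun h i
      simpa [joinMax, hi] using this
    · rw [hL.2.2.1 i hi, hL'.2.2.1 i hi]
  · have := congrFun h (p + 1 + i)
    simp only [joinMax] at this
    rw [if_neg (by omega), if_neg (by omega), if_neg (by omega), if_neg (by omega),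
      show p + 1 + i - p - 1 = i by omega] at this
    exact this

lemma IsAvoider.exists_eq_max {n : ℕ} {w : ℕ → ℤ} (hw : IsAvoider (n + 1) w) :
    ∃ j ≤ n, w j = n + 1 := by
  by_contra! hne
  have : #(range (n + 1)) ≤ #(Icc (1 : ℤ) n) := by
    refine card_le_card_of_injOn w (fun i hi => ?_) fun i hi j hj h => ?_
    · simp only [coe_range, Set.mem_Iio] at hi
      have h1 := hw.1 i hi
      have h2 := hne i (by omega)
      simp only [coe_Icc, Set.mem_Icc]
      push_cast at h1
      omega
    · simp only [coe_range, Set.mem_Iio] at hi hj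
      exact hw.2.1 i hi j hj h
  simp at this

lemma IsAvoider.exists_joinMax {n : ℕ} {w : ℕ → ℤ} (hw : IsAvoider (n + 1) w) :
    ∃ p q L R, p + q = n ∧ IsAvoider p L ∧ IsAvoider q R ∧ joinMax p q L R = w := by
  obtain ⟨p, hp, hmax⟩ := hw.exists_eq_max
  obtain ⟨q, rfl⟩ := Nat.exists_eq_add_of_le hp
  obtain ⟨h1, h2, h3, h4⟩ := hw
  push_cast at h1 hmax
  have hlt : ∀ i < p + q + 1, i ≠ p → w i ≤ p + q := fun i hi hne => by
    have := h1 i hi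
    have : w i ≠ w p := fun e => hne (h2 i hi p (by omega) e)
    omega
  have hcross : ∀ i < p, ∀ k, p < k → k < p + q + 1 → w k < w i := fun i hi k hk hkn => by
    have a := h4 i p k hi hk hkn
    have b := hlt k hkn hk.ne'
    have : w i ≠ w k := fun e => (hi.trans hk).ne (h2 i (by omega) k hkn e)
    omega
  have hlow : ∀ i < p, (q : ℤ) + 1 ≤ w i := fun i hi => by
    have : #(range q) ≤ #(Icc (1 : ℤ) (w i - 1)) := by
      refine card_le_card_of_injOn (fun t => w (p + 1 + t)) (fun t ht => ?_) fun s hs t ht h => ?_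
      · simp only [coe_range, Set.mem_Iio] at ht
        have := h1 (p + 1 + t) (by omega)
        have := hcross i hi (p + 1 + t) (by omega) (by omega)
        simp only [coe_Icc, Set.mem_Icc]
        omega
      · simp only [coe_range, Set.mem_Iio] at hs ht
        have := h2 (p + 1 + s) (by omega) (p + 1 + t) (by omega) h
        omega
    simp only [card_range, Int.card_Icc] at this
    have := h1 i (by omega)
    omega
  have hhigh : ∀ k, p < k → k < p + q + 1 → w k ≤ q := fun k hk hkn => by
    have : #(range p) ≤ #(Icc (w k + 1) ((p : ℤ) + q)) := by
      refine card_le_card_of_injOn w (fun t ht => ?_) fun s hs t ht h => ?_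
      · simp only [coe_range, Set.mem_Iio] at ht
        have := hlt t (by omega) ht.ne
        have := hcross t ht k hk hkn
        simp only [coe_Icc, Set.mem_Icc]
        omega
      · simp only [coe_range, Set.mem_Iio] at hs ht
        exact h2 s (by omega) t (by omega) h
    simp only [card_range, Int.card_Icc] at this
    have := hlt k hkn hk.ne'
    omega
  have hL : ∀ i < p, (if i < p then w i - q else 0) = w i - q := fun i hi => if_pos hi
  refine ⟨p, q, fun i => if i < p then w i - q else 0, fun i => w (p + 1 + i), rfl,
    ⟨fun i hi => ?_, fun i hi j hj h => ?_, fun i hi => if_neg (by omega),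
      fun i j k hij hjk hk => ?_⟩,
    ⟨fun i hi => ?_, fun i hi j hj h => ?_, fun i hi => h3 _ (by omega),
      fun i j k hij hjk hk => h4 _ _ _ (by omega) (by omega) (by omega)⟩, funext fun i => ?_⟩
  · have := hlow i hi
    have := hlt i (by omega) hi.ne
    simp only [hL i hi]
    omega
  · simp only [hL i hi, hL j hj] at h
    exact h2 i (by omega) j (by omega) (by omega)
  · have := h4 i j k hij hjk (by omega)
    simp only [hL i (by omega), hL j (by omega), hL k hk]
    omega
  · exact ⟨(h1 _ (by omega)).1, hhigh _ (by omega) (by omega)⟩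
  · have := h2 _ (by omega) _ (by omega) h
    omega
  · rcases lt_trichotomy i p with h | rfl | h
    · simp [joinMax, h]
    · simp [joinMax, hmax]
    · simp only [joinMax, h.not_gt, h.ne', if_false]
      congr 1
      omega

open Polynomial in
/-- The descent polynomial of the 1-3-2-avoiding permutations of length `n`. -/
noncomputable def desPoly (n : ℕ) : ℚ[X] := ∑ w ∈ avoiders n, X ^ desNat n w

lemma coeff_desPoly (n k : ℕ) :
    (desPoly n).coeff k = #{w ∈ avoiders n | desNat n w = k} := by
  simp [desPoly, Polynomial.finsetSum_coeff, Polynomial.coeff_X_pow, eq_comm]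

lemma desPoly_zero : desPoly 0 = 1 := by
  have : avoiders 0 = {0} := by
    ext w
    simp [IsAvoider, funext_iff]
  simp [desPoly, this, desNat]

lemma desPoly_succ (n : ℕ) : desPoly (n + 1) =
    ∑ pq ∈ antidiagonal n,
      desPoly pq.1 * ((if pq.2 = 0 then 1 else Polynomial.X) * desPoly pq.2) := by
  have key : ∀ pq ∈ antidiagonal n,
      desPoly pq.1 * ((if pq.2 = 0 then 1 else Polynomial.X) * desPoly pq.2) =
        ∑ LR ∈ avoiders pq.1 ×ˢ avoiders pq.2,
          (Polynomial.X : Polynomial ℚ) ^ desNat (n + 1) (joinMax pq.1 pq.2 LR.1 LR.2) := by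
    rintro ⟨p, q⟩ hpq
    obtain rfl : p + q = n := mem_antidiagonal.1 hpq
    simp only [desPoly, sum_product, mul_sum, sum_mul]
    rw [sum_comm]
    refine sum_congr rfl fun L hL => sum_congr rfl fun R hR => ?_
    rw [desNat_joinMax (mem_avoiders.1 hL) (mem_avoiders.1 hR), pow_add, pow_add]
    split_ifs <;> ring
  rw [sum_congr rfl key, sum_sigma', desPoly]
  symm
  refine sum_bij (fun a _ => joinMax a.1.1 a.1.2 a.2.1 a.2.2) ?_ ?_ ?_ fun _ _ => rfl
  · rintro ⟨⟨p, q⟩, L, R⟩ ha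
    simp only [mem_sigma, HasAntidiagonal.mem_antidiagonal, mem_product, mem_avoiders] at ha ⊢
    exact ha.1 ▸ isAvoider_joinMax ha.2.1 ha.2.2
  · rintro ⟨⟨p, q⟩, L, R⟩ ha ⟨⟨p', q'⟩, L', R'⟩ hb h
    simp only [mem_sigma, HasAntidiagonal.mem_antidiagonal, mem_product, mem_avoiders] at ha hb
    obtain ⟨rfl, rfl, rfl, rfl⟩ :=
      joinMax_injective ha.2.1 ha.2.2 hb.2.1 hb.2.2 (ha.1.trans hb.1.symm) h
    rfl
  · intro w hw
    obtain ⟨p, q, L, R, hpq, hL, hR, rfl⟩ := (mem_avoiders.1 hw).exists_joinMax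
    exact ⟨⟨(p, q), L, R⟩, by simp [hpq, hL, hR], rfl⟩

/-- The Narayana numbers. -/
def narayana (n k : ℕ) : ℚ := (n.choose k * n.choose (k + 1)) / n

lemma choose_succ_cast (n k : ℕ) :
    (n.choose (k + 1) : ℚ) = n.choose k * (n - k) / (k + 1) := by
  rw [eq_div_iff (by positivity)]
  rcases le_or_gt k n with h | h
  · have := Nat.choose_succ_right_eq n k
    rw [← Nat.cast_sub h]
    exact_mod_cast this
  · simp [Nat.choose_eq_zero_of_lt h, Nat.choose_eq_zero_of_lt (h.trans k.lt_succ_self)]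

lemma narayana_rec (a k : ℕ) :
    ((a : ℚ) + 4) * narayana (a + 3) (k + 2) =
      (2 * a + 5) * (narayana (a + 2) (k + 2) + narayana (a + 2) (k + 1)) -
      (a + 1) * (narayana (a + 1) (k + 2) - 2 * narayana (a + 1) (k + 1) + narayana (a + 1) k) := by
  simp only [narayana, Nat.choose_succ_succ' (a + 2), Nat.choose_succ_succ' (a + 1)]
  simp only [choose_succ_cast (a + 1), Nat.cast_add]
  push_cast
  field_simp
  ring

lemma narayana_rec_zero (a : ℕ) :
    ((a : ℚ) + 4) * narayana (a + 3) 0 =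
      (2 * a + 5) * narayana (a + 2) 0 - (a + 1) * narayana (a + 1) 0 := by
  simp [narayana]
  field_simp
  ring

lemma narayana_rec_one (a : ℕ) :
    ((a : ℚ) + 4) * narayana (a + 3) 1 =
      (2 * a + 5) * (narayana (a + 2) 1 + narayana (a + 2) 0) -
      (a + 1) * (narayana (a + 1) 1 - 2 * narayana (a + 1) 0) := by
  simp [narayana, choose_succ_cast]
  field_simp
  ring

open PowerSeries in
/-- The linear recurrence in `n` implied by the quadratic recurrence for the descent polynomials. -/
lemma linear_rec_of_quadratic_rec (P : ℕ → Polynomial ℚ)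
    (h0 : P 0 = 1)
    (h : ∀ n, P (n + 1) = ∑ pq ∈ antidiagonal n,
      P pq.1 * ((if pq.2 = 0 then 1 else Polynomial.X) * P pq.2)) (a : ℕ) :
    ((a : Polynomial ℚ) + 4) * P (a + 3) =
      (2 * (a : Polynomial ℚ) + 5) * ((1 + Polynomial.X) * P (a + 2)) -
        ((a : Polynomial ℚ) + 1) * ((1 - Polynomial.X) ^ 2 * P (a + 1)) := by
  set x : PowerSeries (Polynomial ℚ) := C Polynomial.X with hx
  set G : PowerSeries (Polynomial ℚ) := mk P with hG
  have hK : mk (fun q => (if q = 0 then 1 else Polynomial.X) * P q) = 1 + x * (G - 1) := by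
    ext1 n
    rcases n with _ | n <;> simp [hx, hG, h0, coeff_one]
  have hquad : G = 1 + X * (G * (1 + x * (G - 1))) := by
    rw [← hK]
    ext1 n
    rcases n with _ | n
    · simp [hG, h0]
    · rw [hG, coeff_mk, h, map_add, coeff_succ_X_mul, coeff_mul, coeff_one, if_neg n.succ_ne_zero,
        zero_add]
      simp
  set W : PowerSeries (Polynomial ℚ) := 2 * (X * (x * G)) + (X - X * x - 1) with hW
  have hW2 : W * W = 1 - 2 * ((1 + x) * X) + (1 - x) ^ 2 * X ^ 2 := by
    rw [hW]
    linear_combination (-4 * x * X) * hquad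
  have hc3 : (2 : PowerSeries (Polynomial ℚ)) = C 2 := (map_ofNat C 2).symm
  have hdx : d⁄dX (Polynomial ℚ) x = 0 := derivative_C
  have hd : 2 * (W * d⁄dX (Polynomial ℚ) W) = -2 * (1 + x) + 2 * ((1 - x) ^ 2 * X) := by
    have hd2 : d⁄dX (Polynomial ℚ) (2 : PowerSeries (Polynomial ℚ)) = 0 :=
      hc3 ▸ derivative_C
    have := congrArg (d⁄dX (Polynomial ℚ)) hW2
    simp [Derivation.leibniz, hdx, hd2, Derivation.leibniz_pow] at this
    linear_combination this
  have hode : d⁄dX (Polynomial ℚ) W - 2 * (1 + x) * (X * d⁄dX (Polynomial ℚ) W)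
      + (1 - x) ^ 2 * (X * (X * d⁄dX (Polynomial ℚ) W)) =
      -(1 + x) * W + (1 - x) ^ 2 * (X * W) := by
    refine mul_left_cancel₀ (show (2 : PowerSeries (Polynomial ℚ)) ≠ 0 from fun e => ?_) ?_
    · simpa [hc3] using congrArg (coeff 0) e
    linear_combination W * hd - 2 * d⁄dX (Polynomial ℚ) W * hW2
  have hc1 : (1 + x) = C (1 + Polynomial.X) := by simp [hx]
  have hc2 : (1 - x) = C (1 - Polynomial.X) := by simp [hx]
  have hcW : ∀ n, coeff (n + 2) W = 2 * (Polynomial.X * P (n + 1)) := fun n => by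
    rw [hW, hc3]
    simp [hx, hG, coeff_succ_X_mul, coeff_one, coeff_X]
  have := congrArg (coeff (a + 3)) hode
  rw [hc1, hc2, hc3] at this
  simp only [← map_mul, ← map_pow, ← map_neg] at this
  simp only [map_add, map_sub, coeff_C_mul, coeff_succ_X_mul, coeff_derivative, hcW] at this
  push_cast at this
  refine mul_left_cancel₀ (show (2 * Polynomial.X : Polynomial ℚ) ≠ 0 by simp) ?_
  linear_combination this

lemma linear_rec_desPoly (a : ℕ) :
    ((a : Polynomial ℚ) + 4) * desPoly (a + 3) =
      (2 * (a : Polynomial ℚ) + 5) * ((1 + Polynomial.X) * desPoly (a + 2)) -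
        ((a : Polynomial ℚ) + 1) * ((1 - Polynomial.X) ^ 2 * desPoly (a + 1)) :=
  linear_rec_of_quadratic_rec desPoly desPoly_zero desPoly_succ a

lemma desPoly_one : desPoly 1 = 1 := by
  simp [desPoly_succ, desPoly_zero]

lemma desPoly_two : desPoly 2 = 1 + Polynomial.X := by
  rw [desPoly_succ, Nat.antidiagonal_succ]
  simp [desPoly_zero, desPoly_one, add_comm]

lemma coeff_desPoly_succ (a k : ℕ) : (desPoly (a + 1)).coeff k = narayana (a + 1) k := by
  induction a using Nat.twoStepInduction generalizing k with
  | zero =>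
    rw [desPoly_one, Polynomial.coeff_one]
    rcases k with _ | k <;> simp [narayana, Nat.choose_eq_zero_of_lt]
  | one =>
    rw [desPoly_two]
    rcases k with _ | _ | k <;>
      simp [narayana, Polynomial.coeff_one, Polynomial.coeff_X, Nat.choose_eq_zero_of_lt]
  | more a ih1 ih2 =>
    have hrec := congrArg (fun p => p.coeff k) (linear_rec_desPoly a)
    have h1 : (1 + Polynomial.X) * desPoly (a + 2) =
        desPoly (a + 2) + Polynomial.X * desPoly (a + 2) := by ring
    have h2 : (1 - Polynomial.X) ^ 2 * desPoly (a + 1) =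
        desPoly (a + 1) - Polynomial.C 2 * (Polynomial.X * desPoly (a + 1)) +
          Polynomial.X * (Polynomial.X * desPoly (a + 1)) := by
      rw [map_ofNat]; ring
    rw [h1, h2,
      show (a : Polynomial ℚ) + 4 = Polynomial.C ((a : ℚ) + 4) by simp [map_ofNat Polynomial.C 4],
      show 2 * (a : Polynomial ℚ) + 5 = Polynomial.C (2 * (a : ℚ) + 5) by
        simp [map_ofNat Polynomial.C 2, map_ofNat Polynomial.C 5],
      show (a : Polynomial ℚ) + 1 = Polynomial.C ((a : ℚ) + 1) by simp] at hrec
    have h4 : (a : ℚ) + 4 ≠ 0 := by positivity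
    refine mul_left_cancel₀ h4 ?_
    rcases k with _ | _ | k
    · simp only [Polynomial.coeff_C_mul, Polynomial.coeff_add, Polynomial.coeff_sub,
        Polynomial.coeff_X_mul_zero, ih1, ih2] at hrec
      linear_combination hrec - narayana_rec_zero a
    · simp only [Polynomial.coeff_C_mul, Polynomial.coeff_add, Polynomial.coeff_sub,
        Polynomial.coeff_X_mul, Polynomial.coeff_X_mul_zero, ih1, ih2] at hrec
      linear_combination hrec - narayana_rec_one a
    · simp only [Polynomial.coeff_C_mul, Polynomial.coeff_add, Polynomial.coeff_sub,
        Polynomial.coeff_X_mul, ih1, ih2] at hrec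
      linear_combination hrec - narayana_rec a k

end

/-- For `n ≥ 1` and `0 ≤ k ≤ n-1`, the number of 1-3-2-avoiding
permutations of length `n` with exactly `k` descents is the Narayana number
`N(n,k) = (1/n)·C(n,k)·C(n,k+1)`. -/
theorem card_avoids132_des_eq_narayana (n k : ℕ) (hn : 1 ≤ n) (hk : k ≤ n - 1) :
    (Nat.card {π : Fin n → ℤ // IsPermSeq n π ∧ Avoids132 π ∧ des π = k} : ℚ) =
      ((n.choose k : ℚ) * (n.choose (k + 1) : ℚ)) / n := by
  obtain ⟨a, rfl⟩ := Nat.exists_eq_add_of_le' hn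
  rw [natCard_eq_card_avoiders, ← coeff_desPoly, coeff_desPoly_succ, narayana]
end

section
/- For n ≥ 0 define the polynomial D_n(x) = Σ_{π ∈ S_n(1-3-2)} x^{des(π)} (with D_0 = 1), where des(π) is the number of descents of π. Then for all n ≥ 0, D_{n+1}(x) = D_n(x) + x · Σ_{a+b=n, b≥1} D_a(x)·D_b(x). -/
open Finset Polynomial

/-- `w` is a 1-3-2-avoiding permutation of length `n`, extended by zero to all of `ℕ`. -/
structure IsPaddedPerm (n : ℕ) (w : ℕ → ℤ) : Prop where
  one_le : ∀ i < n, 1 ≤ w i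
  le_length : ∀ i < n, w i ≤ n
  inj : ∀ i < n, ∀ j < n, w i = w j → i = j
  eq_zero : ∀ i, n ≤ i → w i = 0
  avoids : ∀ i j k, i < j → j < k → k < n → ¬(w i < w k ∧ w k < w j)

/-- The number of descents of `w` among its first `n` letters. -/
def prefixDes (n : ℕ) (w : ℕ → ℤ) : ℕ :=
  ∑ i ∈ range (n - 1), if w (i + 1) < w i then 1 else 0

/-- Extension of a finite sequence by zero. -/
def zeroPad {n : ℕ} (π : Fin n → ℤ) (i : ℕ) : ℤ :=
  if h : i < n then π ⟨i, h⟩ else 0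

/-- The sequence `(u + b), a + b + 1, v`, with `u` of length `a` and `v` of length `b`. -/
def glue (a b : ℕ) (u v : ℕ → ℤ) (i : ℕ) : ℤ :=
  if i < a then u i + b else if i = a then a + b + 1 else v (i - a - 1)

theorem zeroPad_apply {n : ℕ} (π : Fin n → ℤ) (i : Fin n) : zeroPad π i = π i := by
  simp [zeroPad]

theorem zeroPad_of_lt {n : ℕ} (π : Fin n → ℤ) {i : ℕ} (h : i < n) :
    zeroPad π i = π ⟨i, h⟩ := by
  simp [zeroPad, h]

theorem zeroPad_injective (n : ℕ) : Function.Injective (zeroPad (n := n)) := by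
  intro π σ h
  funext i
  rw [← zeroPad_apply π, h, zeroPad_apply]

theorem isPaddedPerm_zeroPad_iff {n : ℕ} (π : Fin n → ℤ) :
    IsPaddedPerm n (zeroPad π) ↔ IsPermSeq n π ∧ Avoids132 π := by
  constructor
  · intro h
    refine ⟨⟨fun i j hij => ?_, fun i => ⟨?_, ?_⟩⟩, fun i j k hij hjk => ?_⟩
    · exact Fin.ext (h.inj i i.2 j j.2 (by simpa only [zeroPad_apply] using hij))
    · simpa only [zeroPad_apply] using h.one_le i i.2
    · simpa only [zeroPad_apply] using h.le_length i i.2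
    · simpa only [zeroPad_apply] using h.avoids i j k hij hjk k.2
  · rintro ⟨⟨hinj, hb⟩, hav⟩
    refine ⟨fun i hi => ?_, fun i hi => ?_, fun i hi j hj hij => ?_, fun i hi => ?_,
      fun i j k hij hjk hk => ?_⟩
    · rw [zeroPad_of_lt π hi]; exact (hb _).1
    · rw [zeroPad_of_lt π hi]; exact (hb _).2
    · rw [zeroPad_of_lt π hi, zeroPad_of_lt π hj] at hij
      simpa using hinj hij
    · simp [zeroPad, hi.not_gt]
    · rw [zeroPad_of_lt π hk, zeroPad_of_lt π (hjk.trans hk),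
        zeroPad_of_lt π (hij.trans (hjk.trans hk))]
      exact hav _ _ _ hij hjk

theorem prefixDes_zeroPad {n : ℕ} (π : Fin n → ℤ) : prefixDes n (zeroPad π) = des π := by
  rw [prefixDes, ← card_filter, des, ← Fintype.card_coe, ← Nat.card_eq_fintype_card]
  refine Nat.card_congr
    ⟨fun i => ⟨(⟨i.1, ?_⟩, ⟨i.1 + 1, ?_⟩), rfl, ?_⟩, fun p => ⟨p.1.1, ?_⟩, ?_, ?_⟩
  · have := mem_range.1 (mem_filter.1 i.2).1
    omega
  · have := mem_range.1 (mem_filter.1 i.2).1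
    omega
  · have := (mem_filter.1 i.2).2
    rwa [zeroPad_of_lt, zeroPad_of_lt] at this
  · obtain ⟨⟨p, q⟩, hpq, hlt⟩ := p
    have hq := q.2
    dsimp only at hpq hlt
    have hdes : zeroPad π (p + 1) < zeroPad π p := by
      rwa [← hpq, zeroPad_apply, zeroPad_apply]
    exact mem_filter.2 ⟨mem_range.2 (show (p : ℕ) < n - 1 by omega), hdes⟩
  · intro i
    rfl
  · rintro ⟨⟨p, q⟩, hpq, hlt⟩
    ext
    · rfl
    · exact hpq.symm

theorem IsPaddedPerm.exists_zeroPad_eq {n : ℕ} {w : ℕ → ℤ} (h : IsPaddedPerm n w) :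
    ∃ π : Fin n → ℤ, zeroPad π = w := by
  refine ⟨fun i => w i, funext fun i => ?_⟩
  by_cases hi : i < n
  · simp [zeroPad, hi]
  · simp [zeroPad, hi, h.eq_zero i (not_lt.1 hi)]

theorem finite_isPaddedPerm (n : ℕ) : {w | IsPaddedPerm n w}.Finite := by
  have hfin : (Set.univ.pi fun _ : Fin n => Set.Icc (1 : ℤ) n).Finite :=
    Set.Finite.pi fun _ => Set.finite_Icc _ _
  refine (hfin.image zeroPad).subset fun w hw => ?_
  obtain ⟨π, rfl⟩ := IsPaddedPerm.exists_zeroPad_eq hw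
  exact ⟨π, fun i _ => ((isPaddedPerm_zeroPad_iff π).1 hw).1.2 i, rfl⟩

/-- The finite set of zero-padded 1-3-2-avoiding permutations of length `n`. -/
noncomputable def paddedPerms (n : ℕ) : Finset (ℕ → ℤ) :=
  (finite_isPaddedPerm n).toFinset

theorem mem_paddedPerms {n : ℕ} {w : ℕ → ℤ} : w ∈ paddedPerms n ↔ IsPaddedPerm n w := by
  simp [paddedPerms]

theorem coeff_sum_paddedPerms (n k : ℕ) :
    (∑ w ∈ paddedPerms n, (X : ℤ[X]) ^ prefixDes n w).coeff k =
      (Nat.card {π : Fin n → ℤ // IsPermSeq n π ∧ Avoids132 π ∧ des π = k} : ℤ) := by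
  simp only [finsetSum_coeff, coeff_X_pow]
  rw [← Finset.sum_filter_add_sum_filter_not _ (fun w => k = prefixDes n w)]
  rw [Finset.sum_congr rfl (fun w hw => if_pos (mem_filter.1 hw).2),
    Finset.sum_congr (s₁ := filter (fun w => ¬ k = prefixDes n w) _) rfl
      (fun w hw => if_neg (mem_filter.1 hw).2)]
  simp only [sum_const, smul_zero, add_zero, nsmul_eq_mul, mul_one]
  rw [← Fintype.card_coe, ← Nat.card_eq_fintype_card]
  congr 1
  symm
  refine Nat.card_eq_of_bijective (fun π => ⟨zeroPad π.1, ?_⟩) ⟨?_, ?_⟩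
  · rw [mem_filter, mem_paddedPerms, isPaddedPerm_zeroPad_iff, prefixDes_zeroPad]
    exact ⟨⟨π.2.1, π.2.2.1⟩, π.2.2.2.symm⟩
  · intro π σ h
    exact Subtype.ext (zeroPad_injective n (congrArg Subtype.val h))
  · rintro ⟨w, hw⟩
    rw [mem_filter, mem_paddedPerms] at hw
    obtain ⟨π, rfl⟩ := hw.1.exists_zeroPad_eq
    rw [isPaddedPerm_zeroPad_iff, prefixDes_zeroPad] at hw
    exact ⟨⟨π, hw.1.1, hw.1.2, hw.2.symm⟩, rfl⟩

theorem sum_paddedPerms_zero : ∑ w ∈ paddedPerms 0, (X : ℤ[X]) ^ prefixDes 0 w = 1 := by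
  have h : paddedPerms 0 = {0} := by
    ext w
    rw [mem_paddedPerms, mem_singleton]
    constructor
    · exact fun h => funext fun i => h.eq_zero i (Nat.zero_le i)
    · rintro rfl
      constructor <;> simp
  simp [h, prefixDes]

theorem glue_of_lt {a b i : ℕ} (u v : ℕ → ℤ) (h : i < a) : glue a b u v i = u i + b := by
  simp [glue, h]

theorem glue_self (a b : ℕ) (u v : ℕ → ℤ) : glue a b u v a = a + b + 1 := by
  simp [glue]

theorem glue_add (a b i : ℕ) (u v : ℕ → ℤ) : glue a b u v (a + 1 + i) = v i := by
  simp [glue, show ¬ a + 1 + i < a by omega, show ¬ a + 1 + i = a by omega,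
    show a + 1 + i - a - 1 = i by omega]

theorem IsPaddedPerm.glue {a b : ℕ} {u v : ℕ → ℤ} (hu : IsPaddedPerm a u)
    (hv : IsPaddedPerm b v) : IsPaddedPerm (a + b + 1) (glue a b u v) := by
  obtain ⟨u1, u2, u3, u4, u5⟩ := hu
  obtain ⟨v1, v2, v3, v4, v5⟩ := hv
  have cases : ∀ i < a + b + 1, (i < a ∧ _root_.glue a b u v i = u i + b ∧ 1 ≤ u i ∧ u i ≤ a) ∨
      (i = a ∧ _root_.glue a b u v i = a + b + 1) ∨
      (a < i ∧ i - a - 1 < b ∧ _root_.glue a b u v i = v (i - a - 1) ∧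
        1 ≤ v (i - a - 1) ∧ v (i - a - 1) ≤ b) := by
    intro i hi
    rcases lt_trichotomy i a with h | h | h
    · exact Or.inl ⟨h, glue_of_lt u v h, u1 i h, u2 i h⟩
    · subst h; exact Or.inr (Or.inl ⟨rfl, glue_self _ _ _ _⟩)
    · have hb : i - a - 1 < b := by omega
      refine Or.inr (Or.inr ⟨h, hb, ?_, v1 _ hb, v2 _ hb⟩)
      simp [_root_.glue, h.not_gt, h.ne']
  constructor
  · intro i hi
    have := cases i hi
    omega
  · intro i hi
    have := cases i hi
    push_cast
    omega
  · intro i hi j hj hij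
    have h1 := u3 i
    have h2 := v3 (i - a - 1)
    have h3 := cases i hi
    have h4 := cases j hj
    by_cases hia : i < a
    · have := h1 hia j
      omega
    · by_cases hib : i - a - 1 < b
      · have := h2 hib (j - a - 1)
        omega
      · omega
  · intro i hi
    have := v4 (i - a - 1) (by omega)
    simp [_root_.glue, show ¬ i < a by omega, show ¬ i = a by omega, this]
  · intro i j k hij hjk hk
    have h1 := u5 i j k hij hjk
    have h2 := fun h : a < i => v5 (i - a - 1) (j - a - 1) (k - a - 1) (by omega) (by omega)
      (by omega)
    have h3 := cases i (by omega)
    have h4 := cases j (by omega)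
    have h5 := cases k hk
    omega

theorem prefixDes_glue {a b : ℕ} {u v : ℕ → ℤ} (hu : IsPaddedPerm a u) (hv : IsPaddedPerm b v) :
    prefixDes (a + b + 1) (glue a b u v) =
      prefixDes a u + prefixDes b v + if b = 0 then 0 else 1 := by
  unfold prefixDes
  rw [Nat.add_sub_cancel, sum_range_add]
  have hleft : (∑ i ∈ range a, if glue a b u v (i + 1) < glue a b u v i then 1 else 0) =
      ∑ i ∈ range (a - 1), if u (i + 1) < u i then 1 else 0 := by
    cases a with
    | zero => simp
    | succ c =>
      rw [sum_range_succ, glue_self, glue_of_lt u v (Nat.lt_succ_self c), if_neg, add_zero]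
      · refine sum_congr rfl fun i hi => ?_
        have hi := mem_range.1 hi
        rw [glue_of_lt u v (by omega), glue_of_lt u v (by omega)]
        simp
      · have := hu.le_length c (by omega)
        push_cast at *
        omega
  have hright : (∑ i ∈ range b,
      if glue a b u v (a + i + 1) < glue a b u v (a + i) then 1 else 0) =
      (∑ i ∈ range (b - 1), if v (i + 1) < v i then 1 else 0) + if b = 0 then 0 else 1 := by
    cases b with
    | zero => simp
    | succ c =>
      rw [sum_range_succ']
      congr 1
      · refine sum_congr rfl fun i _ => ?_
        rw [show a + (i + 1) + 1 = a + 1 + (i + 1) by omega,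
          show a + (i + 1) = a + 1 + i by omega, glue_add, glue_add]
      · have := hv.le_length 0 (by omega)
        rw [add_zero, show a + 1 = a + 1 + 0 from rfl, glue_add, glue_self, if_pos]
        · simp
        · push_cast at *
          omega
  rw [hleft, hright, add_assoc]

theorem card_le_of_injOn_Icc {s : Finset ℕ} {w : ℕ → ℤ} {p q : ℤ}
    (hmem : ∀ i ∈ s, p ≤ w i ∧ w i ≤ q) (hinj : Set.InjOn w s) :
    #s ≤ (q + 1 - p).toNat := by
  rw [← Int.card_Icc]
  exact card_le_card_of_injOn w (fun i hi => by simpa using hmem i hi) hinj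

theorem IsPaddedPerm.exists_eq_succ {n : ℕ} {w : ℕ → ℤ} (h : IsPaddedPerm (n + 1) w) :
    ∃ a ≤ n, w a = n + 1 := by
  by_contra! hne
  have hcard := card_le_of_injOn_Icc (s := range (n + 1)) (w := w) (p := 1) (q := n)
    (fun i hi => by
      have hi := mem_range.1 hi
      have h1 := h.le_length i hi
      have h2 := hne i (by omega)
      push_cast at h1
      exact ⟨h.one_le i hi, by omega⟩)
    (fun i hi j hj => h.inj i (by simpa using hi) j (by simpa using hj))
  rw [card_range] at hcard
  omega

theorem IsPaddedPerm.exists_glue {a b : ℕ} {w : ℕ → ℤ} (h : IsPaddedPerm (a + b + 1) w)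
    (ha : w a = a + b + 1) :
    ∃ u v, IsPaddedPerm a u ∧ IsPaddedPerm b v ∧ _root_.glue a b u v = w := by
  have hle : ∀ i < a + b + 1, w i ≤ a + b + 1 := fun i hi => by
    simpa using h.le_length i hi
  have hne : ∀ i < a + b + 1, i ≠ a → w i < a + b + 1 := fun i hi hia =>
    lt_of_le_of_ne (hle i hi) fun h' => hia (h.inj i hi a (by omega) (by rw [h', ha]))
  have hsep : ∀ i < a, ∀ k, a < k → k < a + b + 1 → w k < w i := by
    intro i hi k hk hkn
    have h1 := h.avoids i a k hi hk hkn
    have h2 := hne k hkn (by omega)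
    have h3 := h.inj i (by omega) k hkn
    by_contra! hlt
    rcases hlt.lt_or_eq with hlt | heq
    · exact h1 ⟨hlt, by omega⟩
    · have := h3 heq
      omega
  have hlow : ∀ i < a, (b : ℤ) + 1 ≤ w i := by
    intro i hi
    have hcard := card_le_of_injOn_Icc (s := Ico (a + 1) (a + b + 1)) (w := w) (p := 1)
      (q := w i - 1)
      (fun k hk => by
        have hk := mem_Ico.1 hk
        have := hsep i hi k (by omega) (by omega)
        exact ⟨h.one_le k (by omega), by omega⟩)
      (fun k hk l hl => by
        simp only [coe_Ico, Set.mem_Ico] at hk hl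
        exact h.inj k (by omega) l (by omega))
    rw [Nat.card_Ico] at hcard
    have := h.one_le i (by omega)
    omega
  have hhigh : ∀ k, a < k → k < a + b + 1 → w k ≤ b := by
    intro k hk hkn
    have hcard := card_le_of_injOn_Icc (s := range a) (w := w) (p := w k + 1) (q := a + b)
      (fun i hi => by
        have hi := mem_range.1 hi
        have h1 := hsep i hi k hk hkn
        have h2 := hne i (by omega) (by omega)
        exact ⟨by omega, by omega⟩)
      (fun i hi j hj => by
        simp only [coe_range, Set.mem_Iio] at hi hj
        exact h.inj i (by omega) j (by omega))
    rw [card_range] at hcard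
    have := hne k hkn (by omega)
    omega
  refine ⟨fun i => if i < a then w i - b else 0, fun i => w (a + 1 + i), ?_, ?_, ?_⟩
  · refine ⟨fun i hi => ?_, fun i hi => ?_, fun i hi j hj hij => ?_, fun i hi => ?_,
      fun i j k hij hjk hk => ?_⟩
    · have := hlow i hi
      simp only [hi, if_true]
      omega
    · have := hne i (by omega) (by omega)
      simp only [hi, if_true]
      omega
    · simp only [hi, hj, if_true] at hij
      exact h.inj i (by omega) j (by omega) (by omega)
    · exact if_neg hi.not_gt
    · have := h.avoids i j k hij hjk (by omega)
      simp only [hk, hjk.trans hk, hij.trans (hjk.trans hk), if_true]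
      omega
  · refine ⟨fun i hi => h.one_le _ (by omega), fun i hi => hhigh _ (by omega) (by omega),
      fun i hi j hj hij => ?_, fun i hi => h.eq_zero _ (by omega),
      fun i j k hij hjk hk => h.avoids _ _ _ (by omega) (by omega) (by omega)⟩
    have := h.inj _ (by omega) _ (by omega) hij
    omega
  · funext i
    rcases lt_trichotomy i a with hi | hi | hi
    · rw [glue_of_lt _ _ hi]
      simp [hi]
    · rw [hi, glue_self, ha]
    · obtain ⟨c, rfl⟩ := Nat.exists_eq_add_of_lt hi
      rw [show a + c + 1 = a + 1 + c by omega, glue_add]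

theorem le_of_glue_eq {a b a' b' : ℕ} {u v u' v' : ℕ → ℤ} (hab : a + b = a' + b')
    (hu' : IsPaddedPerm a' u') (h : glue a b u v = glue a' b' u' v') : a' ≤ a := by
  by_contra! hlt
  have h1 := congrFun h a
  rw [glue_self, glue_of_lt _ _ hlt] at h1
  have := hu'.le_length a hlt
  omega

theorem glue_inj {a b : ℕ} {u v u' v' : ℕ → ℤ} (hu : IsPaddedPerm a u) (hu' : IsPaddedPerm a u')
    (h : glue a b u v = glue a b u' v') : u = u' ∧ v = v' := by
  refine ⟨funext fun i => ?_, funext fun i => ?_⟩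
  · by_cases hi : i < a
    · have := congrFun h i
      rwa [glue_of_lt _ _ hi, glue_of_lt _ _ hi, add_left_inj] at this
    · rw [hu.eq_zero i (not_lt.1 hi), hu'.eq_zero i (not_lt.1 hi)]
  · have := congrFun h (a + 1 + i)
    rwa [glue_add, glue_add] at this

theorem sum_paddedPerms_succ (n : ℕ) :
    ∑ w ∈ paddedPerms (n + 1), (X : ℤ[X]) ^ prefixDes (n + 1) w =
      ∑ b ∈ range (n + 1), X ^ (if b = 0 then 0 else 1) *
        ((∑ u ∈ paddedPerms (n - b), X ^ prefixDes (n - b) u) *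
          ∑ v ∈ paddedPerms b, X ^ prefixDes b v) := by
  simp_rw [sum_mul_sum, ← sum_product', mul_sum]
  rw [sum_sigma']
  symm
  refine sum_bij (fun p _ => glue (n - p.1) p.1 p.2.1 p.2.2) ?_ ?_ ?_ ?_
  · rintro ⟨b, u, v⟩ hp
    simp only [mem_sigma, mem_product, mem_range, mem_paddedPerms] at hp ⊢
    obtain ⟨hb, hu, hv⟩ := hp
    have := hu.glue hv
    rwa [show n - b + b = n by omega] at this
  · rintro ⟨b, u, v⟩ hp ⟨b', u', v'⟩ hp' heq
    simp only [mem_sigma, mem_product, mem_range, mem_paddedPerms] at hp hp' heq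
    obtain ⟨hb, hu, hv⟩ := hp
    obtain ⟨hb', hu', hv'⟩ := hp'
    have h1 := le_of_glue_eq (by omega) hu' heq
    have h2 := le_of_glue_eq (by omega) hu heq.symm
    obtain rfl : b = b' := by omega
    obtain ⟨rfl, rfl⟩ := glue_inj hu hu' heq
    rfl
  · intro w hw
    rw [mem_paddedPerms] at hw
    obtain ⟨a, ha, hwa⟩ := hw.exists_eq_succ
    obtain ⟨b, rfl⟩ := Nat.exists_eq_add_of_le ha
    obtain ⟨u, v, hu, hv, rfl⟩ := hw.exists_glue (by simpa using hwa)
    refine ⟨⟨b, u, v⟩, ?_, ?_⟩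
    · simp only [mem_sigma, mem_product, mem_range, mem_paddedPerms, Nat.add_sub_cancel]
      exact ⟨by omega, hu, hv⟩
    · simp
  · rintro ⟨b, u, v⟩ hp
    simp only [mem_sigma, mem_product, mem_range, mem_paddedPerms] at hp ⊢
    obtain ⟨hb, hu, hv⟩ := hp
    have := prefixDes_glue hu hv
    rw [show n - b + b = n by omega] at this
    rw [this]
    ring

/-- The polynomials `D_n(x) = Σ_{π ∈ S_n(1-3-2)} x^{des(π)}`
satisfy `D_{n+1}(x) = D_n(x) + x · Σ_{a+b=n, b≥1} D_a(x)·D_b(x)`. -/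
theorem des_polynomial_recurrence (D : ℕ → Polynomial ℤ)
    (hD : ∀ n k, (D n).coeff k =
      (Nat.card {π : Fin n → ℤ // IsPermSeq n π ∧ Avoids132 π ∧ des π = k} : ℤ)) :
    ∀ n, D (n + 1) =
      D n + Polynomial.X * ∑ b ∈ Finset.Icc 1 n, D (n - b) * D b := by
  have hsum : ∀ n, D n = ∑ w ∈ paddedPerms n, (X : ℤ[X]) ^ prefixDes n w := fun n => by
    ext k
    rw [hD, coeff_sum_paddedPerms]
  intro n
  have hzero : D 0 = 1 := by rw [hsum, sum_paddedPerms_zero]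
  have hsucc : D (n + 1) =
      ∑ b ∈ range (n + 1), X ^ (if b = 0 then 0 else 1) * (D (n - b) * D b) := by
    simp only [hsum, sum_paddedPerms_succ]
  rw [hsucc, range_eq_Ico, sum_eq_sum_Ico_succ_bot (Nat.succ_pos n), mul_sum]
  congr 1
  · simp [hzero]
  · refine sum_congr rfl fun b hb => ?_
    have := mem_Icc.1 hb
    simp [show b ≠ 0 by omega]
end
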